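/- For the KKM potential V_II, the square of the Poisson bracket L = {F,A₁} satisfies L² = 2F₃, where F₃ = 8βA₁² + 8B₂FA₁ − 8F²α − 8B₂²δ − 32αβδ, and consequently {{A₁,F},A₁} = −8A₁B₂ + 16αF and {{A₁,F},F} = 8B₂F + 16βA₁. -/

import Mathlib

noncomputable section

open MvPolynomial

/-- The field of rational functions over ℂ in the six variables
`x, y, z, p_x, p_y, p_z`: the fraction field of the polynomial ring. -/
abbrev K6 : Type := FractionRing (MvPolynomial (Fin 6) ℂ)

/-- The canonical embedding of the polynomial ring into its fraction field. -/
def toK6 : MvPolynomial (Fin 6) ℂ →+* K6 :=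
  algebraMap (MvPolynomial (Fin 6) ℂ) K6

/-- Constants, embedded in `K6`. -/
def cC (a : ℂ) : K6 := toK6 (MvPolynomial.C a)

/-- The imaginary unit `i`, embedded in `K6`. -/
def iC : K6 := cC Complex.I

def vx : K6 := toK6 (MvPolynomial.X 0)
def vy : K6 := toK6 (MvPolynomial.X 1)
def vz : K6 := toK6 (MvPolynomial.X 2)
def vpx : K6 := toK6 (MvPolynomial.X 3)
def vpy : K6 := toK6 (MvPolynomial.X 4)
def vpz : K6 := toK6 (MvPolynomial.X 5)

/-- `D` is the (unique) extension to the fraction field of the formal partial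
derivative `pderiv j` on the polynomial ring: an additive map satisfying the
Leibniz rule which agrees with `pderiv j` on polynomials. -/
def IsPDeriv (j : Fin 6) (D : K6 → K6) : Prop :=
  (∀ f g : K6, D (f + g) = D f + D g) ∧
  (∀ f g : K6, D (f * g) = D f * g + f * D g) ∧
  (∀ p, D (toK6 p) = toK6 (pderiv j p))

/-- The canonical Poisson bracket on `K6`, where `Pd 0, …, Pd 5` are the
partial derivatives with respect to `x, y, z, p_x, p_y, p_z` respectively:
`{f,g} = f_x g_{p_x} + f_y g_{p_y} + f_z g_{p_z}
  - f_{p_x} g_x - f_{p_y} g_y - f_{p_z} g_z`. -/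
def poisson (Pd : Fin 6 → K6 → K6) (f g : K6) : K6 :=
  Pd 0 f * Pd 3 g + Pd 1 f * Pd 4 g + Pd 2 f * Pd 5 g
    - Pd 3 f * Pd 0 g - Pd 4 f * Pd 1 g - Pd 5 f * Pd 2 g

/-- Angular momentum `J_x = y p_z - z p_y`. -/
def Jx : K6 := vy * vpz - vz * vpy
/-- Angular momentum `J_y = z p_x - x p_z`. -/
def Jy : K6 := vz * vpx - vx * vpz
/-- Angular momentum `J_z = x p_y - y p_x`. -/
def Jz : K6 := vx * vpy - vy * vpx
/-- Total angular momentum squared `J² = J_x² + J_y² + J_z²`. -/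
def Jsq : K6 := Jx ^ 2 + Jy ^ 2 + Jz ^ 2

/-- KKM V_II Hamiltonian. -/
def HV (α β γ δ : ℂ) : K6 :=
  vpx ^ 2 + vpy ^ 2 + vpz ^ 2 + cC α * (vx ^ 2 + vy ^ 2 + vz ^ 2)
    + cC β * (vx - iC * vy) / (vx + iC * vy) ^ 3
    + cC γ / (vx + iC * vy) ^ 2 + cC δ / vz ^ 2

def A1V (α δ : ℂ) : K6 := vpz ^ 2 + cC α * vz ^ 2 + cC δ / vz ^ 2

def A2V (β γ : ℂ) : K6 :=
  Jz ^ 2 + 2 * iC * vx * vy * (cC γ - 2 * cC β) / (vx + iC * vy) ^ 2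
    + 2 * cC γ * vx ^ 2 / (vx + iC * vy) ^ 2

def B1V (β γ δ : ℂ) : K6 :=
  Jsq
    + (vz ^ 2 * (cC β * (4 * vx * vy * (vy - iC * vx) + vz ^ 2 * (vx - iC * vy))
        + cC γ * (vx + iC * vy) * (2 * vx * (vx + iC * vy) + vz ^ 2))
      + cC δ * (vx - iC * vy) * (vx + iC * vy) ^ 4)
      / (vz ^ 2 * (vx + iC * vy) ^ 3)

def B2V (α β : ℂ) : K6 :=
  (vpx + iC * vpy) ^ 2 + cC α * (vx + iC * vy) ^ 2 - cC β / (vx + iC * vy) ^ 2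

def FV (β δ : ℂ) : K6 :=
  (Jy - iC * Jx) ^ 2
    + (cC δ * (vx + iC * vy) ^ 4 - cC β * vz ^ 4) / (vz ^ 2 * (vx + iC * vy) ^ 2)

/-- The complex coordinate `x + iy`. -/
def vw : K6 := vx + iC * vy

/-- The complex momentum `p_x + i p_y`. -/
def vP : K6 := vpx + iC * vpy

/-- The complex angular momentum `J_y - i J_x` in the coordinates `vw`, `vz`, `vP`, `vpz`. -/
def complexJ : K6 := vz * vP - vw * vpz

/-- The closed form of the bracket `{F, A₁}`. -/
def bracketFA1 (α β δ : ℂ) : K6 :=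
  4 * ((vP * vpz + cC α * (vw * vz)) * complexJ - cC δ * (vw * vP / vz ^ 2)
    - cC β * (vz * vpz / vw ^ 2))

lemma toK6_injective : Function.Injective toK6 :=
  IsFractionRing.injective (MvPolynomial (Fin 6) ℂ) K6

lemma vz_ne_zero : vz ≠ 0 :=
  (map_ne_zero_iff toK6 toK6_injective).2 (X_ne_zero 2)

lemma vw_ne_zero : vw ≠ 0 := by
  have hw : vw = toK6 (X 0 + C Complex.I * X 1) := by
    simp [vw, vx, vy, iC, cC]
  rw [hw]
  refine (map_ne_zero_iff toK6 toK6_injective).2 fun h => ?_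
  simpa using congrArg (pderiv 0) h

lemma iC_sq : iC ^ 2 = -1 := by
  rw [iC, cC, ← map_pow, ← map_pow, Complex.I_sq]
  simp

lemma Jy_sub_iC_mul_Jx : Jy - iC * Jx = complexJ := by
  rw [Jy, Jx, complexJ, vw, vP]
  ring

lemma FV_eq (β δ : ℂ) :
    FV β δ = complexJ ^ 2 + cC δ * (vw ^ 2 / vz ^ 2) - cC β * (vz ^ 2 / vw ^ 2) := by
  have hz := vz_ne_zero
  have hw := vw_ne_zero
  rw [FV, Jy_sub_iC_mul_Jx, ← vw]
  field_simp
  ring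

lemma B2V_eq (α β : ℂ) : B2V α β = vP ^ 2 + cC α * vw ^ 2 - cC β / vw ^ 2 := rfl

namespace IsPDeriv

variable {j : Fin 6} {D : K6 → K6}

lemma map_const (hD : IsPDeriv j D) (a : ℂ) : D (cC a) = 0 := by
  rw [cC, hD.2.2, pderiv_C, map_zero]

lemma map_const_mul (hD : IsPDeriv j D) (a : ℂ) (f : K6) : D (cC a * f) = cC a * D f := by
  rw [hD.2.1, hD.map_const, zero_mul, zero_add]

lemma map_neg (hD : IsPDeriv j D) (f : K6) : D (-f) = -D f := by
  have h := hD.map_const_mul (-1) f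
  simpa [cC] using h

lemma map_sub (hD : IsPDeriv j D) (f g : K6) : D (f - g) = D f - D g := by
  rw [sub_eq_add_neg, hD.1, hD.map_neg, sub_eq_add_neg]

lemma map_sq (hD : IsPDeriv j D) (f : K6) : D (f ^ 2) = 2 * f * D f := by
  rw [pow_two, hD.2.1]
  ring

lemma map_div (hD : IsPDeriv j D) (f : K6) {g : K6} (hg : g ≠ 0) :
    D (f / g) = (D f * g - f * D g) / g ^ 2 := by
  have h := hD.2.1 (f / g) g
  rw [div_mul_cancel₀ f hg] at h
  rw [h]
  field_simp
  ring

lemma map_X (hD : IsPDeriv j D) (k : Fin 6) : D (toK6 (X k)) = if k = j then 1 else 0 := by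
  rw [hD.2.2, pderiv_X, Pi.single_apply]
  split_ifs
  · exact map_one _
  · exact map_zero _

lemma map_vz (hD : IsPDeriv j D) : D vz = if 2 = j then 1 else 0 := hD.map_X 2

lemma map_vpz (hD : IsPDeriv j D) : D vpz = if 5 = j then 1 else 0 := hD.map_X 5

lemma map_vw (hD : IsPDeriv j D) :
    D vw = (if 0 = j then 1 else 0) + iC * (if 1 = j then 1 else 0) := by
  rw [vw, hD.1, iC, hD.map_const_mul, vx, vy, hD.map_X, hD.map_X]

lemma map_vP (hD : IsPDeriv j D) :
    D vP = (if 3 = j then 1 else 0) + iC * (if 4 = j then 1 else 0) := by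
  rw [vP, hD.1, iC, hD.map_const_mul, vpx, vpy, hD.map_X, hD.map_X]

lemma map_complexJ (hD : IsPDeriv j D) :
    D complexJ = D vz * vP + vz * D vP - (D vw * vpz + vw * D vpz) := by
  rw [complexJ, hD.map_sub, hD.2.1, hD.2.1]

lemma map_A1V (hD : IsPDeriv j D) (α δ : ℂ) :
    D (A1V α δ) = 2 * vpz * D vpz + (2 * cC α * vz - 2 * cC δ / vz ^ 3) * D vz := by
  have hz := vz_ne_zero
  rw [A1V, hD.1, hD.1, hD.map_const_mul, hD.map_div _ (pow_ne_zero 2 hz), hD.map_const]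
  simp only [hD.map_sq]
  field_simp
  ring

lemma map_FV (hD : IsPDeriv j D) (β δ : ℂ) :
    D (FV β δ) = 2 * complexJ * D complexJ
      + cC δ * (2 * vw * D vw / vz ^ 2 - 2 * vw ^ 2 * D vz / vz ^ 3)
      - cC β * (2 * vz * D vz / vw ^ 2 - 2 * vz ^ 2 * D vw / vw ^ 3) := by
  have hz := vz_ne_zero
  have hw := vw_ne_zero
  rw [FV_eq, hD.map_sub, hD.1, hD.map_const_mul, hD.map_const_mul,
    hD.map_div _ (pow_ne_zero 2 hz), hD.map_div _ (pow_ne_zero 2 hw)]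
  simp only [hD.map_sq]
  field_simp

lemma map_bracketFA1 (hD : IsPDeriv j D) (α β δ : ℂ) :
    D (bracketFA1 α β δ) =
      4 * ((D vP * vpz + vP * D vpz + cC α * (D vw * vz + vw * D vz)) * complexJ
        + (vP * vpz + cC α * (vw * vz)) * D complexJ
        - cC δ * ((D vw * vP + vw * D vP) / vz ^ 2 - 2 * vw * vP * D vz / vz ^ 3)
        - cC β * ((D vz * vpz + vz * D vpz) / vw ^ 2 - 2 * vz * vpz * D vw / vw ^ 3)) := by
  have hz := vz_ne_zero
  have hw := vw_ne_zero
  have h4 : (4 : K6) = cC 4 := by rw [cC, map_ofNat C 4, map_ofNat toK6 4]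
  rw [bracketFA1, h4, hD.map_const_mul, hD.map_sub, hD.map_sub, hD.map_const_mul,
    hD.map_const_mul, hD.map_div _ (pow_ne_zero 2 hz), hD.map_div _ (pow_ne_zero 2 hw),
    hD.2.1 _ complexJ, hD.1, hD.map_const_mul]
  simp only [hD.map_sq, hD.2.1 _ vpz, hD.2.1 _ vz, hD.2.1 _ vP]
  field_simp

end IsPDeriv

section Bracket

variable {Pd : Fin 6 → K6 → K6}

lemma poisson_antisymm (f g : K6) : poisson Pd f g = -poisson Pd g f := by
  simp only [poisson]
  ring

lemma poisson_neg_left (hPd : ∀ j, IsPDeriv j (Pd j)) (f g : K6) :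
    poisson Pd (-f) g = -poisson Pd f g := by
  simp only [poisson, (hPd _).map_neg]
  ring

/-- For functions of `vw`, `vz`, `vP`, `vpz` only the `z`-part of the bracket survives,
because `{vw, vP} = 0`. -/
lemma poisson_eq_of_complex {f g : K6} (hf : Pd 1 f = iC * Pd 0 f) (hf' : Pd 4 f = iC * Pd 3 f)
    (hg : Pd 1 g = iC * Pd 0 g) (hg' : Pd 4 g = iC * Pd 3 g) :
    poisson Pd f g = Pd 2 f * Pd 5 g - Pd 5 f * Pd 2 g := by
  rw [poisson, hf, hf', hg, hg']
  linear_combination (Pd 0 f * Pd 3 g - Pd 3 f * Pd 0 g) * iC_sq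

lemma pderiv_A1V_complex (hPd : ∀ j, IsPDeriv j (Pd j)) (α δ : ℂ) :
    Pd 1 (A1V α δ) = iC * Pd 0 (A1V α δ) ∧ Pd 4 (A1V α δ) = iC * Pd 3 (A1V α δ) := by
  simp [(hPd _).map_A1V, (hPd _).map_vz, (hPd _).map_vpz]

lemma pderiv_FV_complex (hPd : ∀ j, IsPDeriv j (Pd j)) (β δ : ℂ) :
    Pd 1 (FV β δ) = iC * Pd 0 (FV β δ) ∧ Pd 4 (FV β δ) = iC * Pd 3 (FV β δ) := by
  simp only [(hPd _).map_FV, (hPd _).map_complexJ, (hPd _).map_vz, (hPd _).map_vpz,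
    (hPd _).map_vw, (hPd _).map_vP]
  constructor <;> simp <;> ring

lemma pderiv_bracketFA1_complex (hPd : ∀ j, IsPDeriv j (Pd j)) (α β δ : ℂ) :
    Pd 1 (bracketFA1 α β δ) = iC * Pd 0 (bracketFA1 α β δ) ∧
      Pd 4 (bracketFA1 α β δ) = iC * Pd 3 (bracketFA1 α β δ) := by
  simp only [(hPd _).map_bracketFA1, (hPd _).map_complexJ, (hPd _).map_vz, (hPd _).map_vpz,
    (hPd _).map_vw, (hPd _).map_vP]
  constructor <;> simp <;> ring

lemma poisson_FV_A1V (hPd : ∀ j, IsPDeriv j (Pd j)) (α β δ : ℂ) :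
    poisson Pd (FV β δ) (A1V α δ) = bracketFA1 α β δ := by
  have hz := vz_ne_zero
  have hw := vw_ne_zero
  rw [poisson_eq_of_complex (pderiv_FV_complex hPd β δ).1 (pderiv_FV_complex hPd β δ).2
    (pderiv_A1V_complex hPd α δ).1 (pderiv_A1V_complex hPd α δ).2]
  simp only [(hPd _).map_FV, (hPd _).map_A1V, (hPd _).map_complexJ, (hPd _).map_vz,
    (hPd _).map_vpz, (hPd _).map_vw, (hPd _).map_vP]
  simp [bracketFA1, complexJ]
  field_simp
  ring

lemma poisson_bracketFA1_A1V (hPd : ∀ j, IsPDeriv j (Pd j)) (α β δ : ℂ) :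
    poisson Pd (bracketFA1 α β δ) (A1V α δ) =
      8 * A1V α δ * B2V α β - 16 * cC α * FV β δ := by
  have hz := vz_ne_zero
  have hw := vw_ne_zero
  rw [poisson_eq_of_complex (pderiv_bracketFA1_complex hPd α β δ).1
    (pderiv_bracketFA1_complex hPd α β δ).2
    (pderiv_A1V_complex hPd α δ).1 (pderiv_A1V_complex hPd α δ).2]
  simp only [(hPd _).map_bracketFA1, (hPd _).map_A1V, (hPd _).map_complexJ, (hPd _).map_vz,
    (hPd _).map_vpz, (hPd _).map_vw, (hPd _).map_vP]
  simp [A1V, B2V_eq, FV_eq, complexJ]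
  field_simp
  ring

lemma poisson_bracketFA1_FV (hPd : ∀ j, IsPDeriv j (Pd j)) (α β δ : ℂ) :
    poisson Pd (bracketFA1 α β δ) (FV β δ) =
      -(8 * B2V α β * FV β δ + 16 * cC β * A1V α δ) := by
  have hz := vz_ne_zero
  have hw := vw_ne_zero
  rw [poisson_eq_of_complex (pderiv_bracketFA1_complex hPd α β δ).1
    (pderiv_bracketFA1_complex hPd α β δ).2
    (pderiv_FV_complex hPd β δ).1 (pderiv_FV_complex hPd β δ).2]
  simp only [(hPd _).map_bracketFA1, (hPd _).map_FV, (hPd _).map_complexJ, (hPd _).map_vz,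
    (hPd _).map_vpz, (hPd _).map_vw, (hPd _).map_vP]
  simp [A1V, B2V_eq, FV_eq, complexJ]
  field_simp
  ring

lemma bracketFA1_sq (α β δ : ℂ) :
    bracketFA1 α β δ ^ 2 =
      2 * (8 * cC β * A1V α δ ^ 2 + 8 * B2V α β * FV β δ * A1V α δ - 8 * FV β δ ^ 2 * cC α
        - 8 * B2V α β ^ 2 * cC δ - 32 * cC α * cC β * cC δ) := by
  have hz := vz_ne_zero
  have hw := vw_ne_zero
  simp only [bracketFA1, A1V, B2V_eq, FV_eq, complexJ]
  field_simp
  ring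

end Bracket

theorem kkm_VII_L_sq (α β γ δ : ℂ) (Pd : Fin 6 → K6 → K6)
    (hPd : ∀ j, IsPDeriv j (Pd j))
    (H A1 A2 B1 B2 F : K6)
    (hH : H = HV α β γ δ) (hA1 : A1 = A1V α δ) (hA2 : A2 = A2V β γ)
    (hB1 : B1 = B1V β γ δ) (hB2 : B2 = B2V α β) (hF : F = FV β δ) :
    (poisson Pd F A1) ^ 2 =
      2 * (8 * cC β * A1 ^ 2 + 8 * B2 * F * A1 - 8 * F ^ 2 * cC α
        - 8 * B2 ^ 2 * cC δ - 32 * cC α * cC β * cC δ) ∧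
    poisson Pd (poisson Pd A1 F) A1 = -8 * A1 * B2 + 16 * cC α * F ∧
    poisson Pd (poisson Pd A1 F) F = 8 * B2 * F + 16 * cC β * A1 := by
  subst hA1 hB2 hF
  rw [poisson_antisymm (A1V α δ), poisson_FV_A1V hPd, poisson_neg_left hPd,
    poisson_neg_left hPd, poisson_bracketFA1_A1V hPd, poisson_bracketFA1_FV hPd]
  exact ⟨bracketFA1_sq α β δ, by ring, neg_neg _⟩
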